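/- Let m ≥ 2 and ε > 0, and let H ∈ ℝ^{m×m} be the matrix with H_{ii} = 0 for all i and H_{ij} = ε for all i ≠ j. Then the tropical polytope tconv(H) ⊆ ℝ^{m−1} equals the Hilbert ball B_H(ε) = {y ∈ ℝ^{m−1} : max(0, max_i y_i) − min(0, min_i y_i) ≤ ε}. -/

import Mathlib

open MeasureTheory Pointwise

noncomputable section

/-- Hilbert ball of radius `δ` in `ℝ^n` (chart coordinates). -/
def hilbertBall (n : ℕ) (δ : ℝ) : Set (Fin n → ℝ) :=
  {y | max 0 (⨆ i, y i) - min 0 (⨅ i, y i) ≤ δ}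

/-- Tropical (min-plus) convex hull of the columns of a matrix `A`, viewed in the chart
`x ↦ (x_2 − x_1, …, x_m − x_1)`, i.e. as a subset of `ℝ^(m-1)`. -/
def tconv (m : ℕ) {ι : Type*} (A : Fin m → ι → ℝ) : Set (Fin (m - 1) → ℝ) :=
  {y | ∃ α : ι → ℝ, ∀ k : Fin (m - 1),
      y k = (⨅ j, (α j + A ⟨(k : ℕ) + 1, by have := k.isLt; omega⟩ j))
          - (⨅ j, (α j + A ⟨0, by have := k.isLt; omega⟩ j))}

/-- A square matrix is tropically nonsingular if the minimum over permutations `σ` of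
`∑ i, M i (σ i)` is attained by exactly one permutation. -/
def TropNonsingular {k : ℕ} (M : Fin k → Fin k → ℝ) : Prop :=
  ∃! σ : Equiv.Perm (Fin k), ∀ τ : Equiv.Perm (Fin k),
    ∑ i, M i (σ i) ≤ ∑ i, M i (τ i)

/-- The tropical rank of `A`: the largest `k` such that `A` has a tropically
nonsingular `k × k` submatrix. -/
def tropRank (m n : ℕ) (A : Fin m → Fin n → ℝ) : ℕ :=
  sSup {k : ℕ | ∃ r : Fin k → Fin m, ∃ c : Fin k → Fin n,
    Function.Injective r ∧ Function.Injective c ∧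
    TropNonsingular (fun i j => A (r i) (c j))}

theorem mem_hilbertBall_iff {n : ℕ} [NeZero n] {δ : ℝ} (y : Fin n → ℝ) :
    y ∈ hilbertBall n δ ↔
      (∀ i, y i ≤ δ) ∧ (∀ i, -y i ≤ δ) ∧ ∀ i j, y i - y j ≤ δ := by
  have hsup : ∀ i, y i ≤ ⨆ i, y i := le_ciSup (Set.finite_range y).bddAbove
  have hinf : ∀ i, ⨅ i, y i ≤ y i := ciInf_le (Set.finite_range y).bddBelow
  obtain ⟨a, ha⟩ := exists_eq_ciSup_of_finite (f := y)
  obtain ⟨b, hb⟩ := exists_eq_ciInf_of_finite (f := y)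
  simp only [hilbertBall, Set.mem_ofPred_eq]
  constructor
  · intro h
    have h₁ := le_max_left 0 (⨆ i, y i)
    have h₂ := le_max_right 0 (⨆ i, y i)
    have h₃ := min_le_left 0 (⨅ i, y i)
    have h₄ := min_le_right 0 (⨅ i, y i)
    exact ⟨fun i => by linarith [hsup i], fun i => by linarith [hinf i],
      fun i j => by linarith [hsup i, hinf j]⟩
  · rintro ⟨h₁, h₂, h₃⟩
    rw [← ha, ← hb]
    rcases max_cases 0 (y a) with ⟨h, _⟩ | ⟨h, _⟩ <;>
      rcases min_cases 0 (y b) with ⟨h', _⟩ | ⟨h', _⟩ <;> rw [h, h'] <;>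
      linarith [h₁ a, h₂ a, h₂ b, h₃ a b]

theorem iInf_add_sub_iInf_add_le {ι : Type*} [Finite ι] [Nonempty ι] [DecidableEq ι] {ε : ℝ}
    (hε : 0 ≤ ε) (α : ι → ℝ) (i k : ι) :
    (⨅ j, (α j + if i = j then (0 : ℝ) else ε)) - (⨅ j, (α j + if k = j then (0 : ℝ) else ε))
      ≤ ε := by
  rw [sub_le_comm]
  refine le_ciInf fun j => ?_
  have h := ciInf_le (Set.finite_range fun j => α j + if i = j then (0 : ℝ) else ε).bddBelow j
  split_ifs at h ⊢ <;> linarith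

theorem iInf_add_ite_eq {ι : Type*} [Finite ι] [DecidableEq ι] {ε : ℝ} {x : ι → ℝ}
    (hx : ∀ i j, x i - x j ≤ ε) (i : ι) :
    (⨅ j, (x j + if i = j then (0 : ℝ) else ε)) = x i := by
  have : Nonempty ι := ⟨i⟩
  apply le_antisymm
  · simpa using
      ciInf_le (Set.finite_range fun j => x j + if i = j then (0 : ℝ) else ε).bddBelow i
  · refine le_ciInf fun j => ?_
    split_ifs with h
    · simp [h]
    · linarith [hx i j]

/-- The tropical polytope generated by the matrix with zero diagonal and all off-diagonal
entries equal to `ε` is exactly the Hilbert ball `B_H(ε) ⊆ ℝ^(m-1)`. -/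
theorem stmt18 (m : ℕ) (hm : 2 ≤ m) (ε : ℝ) (hε : 0 < ε) :
    tconv m (fun i j : Fin m => if i = j then (0 : ℝ) else ε) = hilbertBall (m - 1) ε := by
  obtain ⟨n, rfl⟩ : ∃ n, m = n + 1 + 1 := ⟨m - 2, by omega⟩
  ext y
  change Fin (n + 1) → ℝ at y
  change _ ↔ y ∈ hilbertBall (n + 1) ε
  rw [mem_hilbertBall_iff]
  constructor
  · rintro ⟨α, hα⟩
    have hle := iInf_add_sub_iInf_add_le hε.le α
    have hy : ∀ k : Fin (n + 1), y k =
        (⨅ j, (α j + if k.succ = j then (0 : ℝ) else ε)) -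
          ⨅ j, (α j + if 0 = j then (0 : ℝ) else ε) := hα
    refine ⟨fun i => ?_, fun i => ?_, fun i j => ?_⟩
    · rw [hy]; exact hle _ _
    · rw [hy, neg_sub]; exact hle _ _
    · rw [hy, hy, sub_sub_sub_cancel_right]; exact hle _ _
  · rintro ⟨h₁, h₂, h₃⟩
    let x : Fin (n + 1 + 1) → ℝ := Fin.cons 0 y
    have hx : ∀ i j, x i - x j ≤ ε := by
      intro i j
      cases i using Fin.cases <;> cases j using Fin.cases <;> simp [x, hε.le, h₁, h₃]
      linarith [h₂ ‹_›]
    have hmin := iInf_add_ite_eq hx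
    refine ⟨x, fun k => ?_⟩
    change y k = (⨅ j, (x j + if Fin.succ k = j then (0 : ℝ) else ε)) -
      ⨅ j, (x j + if 0 = j then (0 : ℝ) else ε)
    rw [hmin, hmin]
    simp [x]
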